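/- For each pair (A, B) of deterministic Alice and Bob strategies for the Magic Square game, let v(A,B) ∈ ℝ^{(Fin 3 × Fin 3) × V_A × V_B} be the deterministic probability vector with entry v(A,B)(x, y, a, b) = 1 if A x = a and B y = b, and 0 otherwise. Let S be the set of the 144 pairs (A, B) that win on exactly 8 of the 9 input pairs. Then the affine span of {v(A,B) : (A,B) ∈ S} has dimension 98; equivalently, the inequality ∑_{x,y} Pr[a_y^{(x)} = b_x^{(y)}] ≤ 8 is a facet (tight Bell-type inequality) of the local polytope Ω_{34}. -/

import Mathlib

/-- Alice's admissible outputs for the Magic Square game: triples of bits with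
even parity. -/
def MagicVA : Type := {a : Fin 3 → ZMod 2 // a 0 + a 1 + a 2 = 0}

/-- Bob's admissible outputs for the Magic Square game: triples of bits with
odd parity. -/
def MagicVB : Type := {b : Fin 3 → ZMod 2 // b 0 + b 1 + b 2 = 1}

instance : Fintype MagicVA := by unfold MagicVA; infer_instance
instance : Fintype MagicVB := by unfold MagicVB; infer_instance
instance : DecidableEq MagicVA := by unfold MagicVA; infer_instance
instance : DecidableEq MagicVB := by unfold MagicVB; infer_instance

/-- The deterministic probability vector associated to a pair of deterministic
strategies `A : Fin 3 → MagicVA`, `B : Fin 3 → MagicVB`: its entry at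
`((x, y), a, b)` is `1` if `A x = a` and `B y = b`, and `0` otherwise. -/
def detVector (A : Fin 3 → MagicVA) (B : Fin 3 → MagicVB) :
    ((Fin 3 × Fin 3) × MagicVA × MagicVB) → ℝ :=
  fun q => if A q.1.1 = q.2.1 ∧ B q.1.2 = q.2.2 then 1 else 0

namespace MagicSquare

/-- The sign `(-1) ^ z` of a bit. -/
def sign (z : ZMod 2) : ℤ := if z = 0 then 1 else -1

/-- The entry of a triple of bits, as a sign, extended by `1` at `none`. -/
def character (s : Option (Fin 3)) (a : Fin 3 → ZMod 2) : ℤ := s.elim 1 fun j => sign (a j)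

/-- The bits of a square with even rows, even column `y` and two other odd columns. -/
def squareBit (y : Fin 3) (t : ZMod 2 × ZMod 2 × ZMod 2 × ZMod 2) (i j : Fin 3) : ZMod 2 :=
  let u : Fin 3 → ZMod 2 := ![t.1, t.2.1, 1 + t.1 + t.2.1]
  let w : Fin 3 → ZMod 2 := ![t.2.2.1, t.2.2.2, 1 + t.2.2.1 + t.2.2.2]
  if j = y then u i + w i else if j = y + 1 then u i else w i

/-- The entry of the square of `squareBit`, as a sign, extended by `1` at `none`. -/
def squareSign (y : Fin 3) (t : ZMod 2 × ZMod 2 × ZMod 2 × ZMod 2)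
    (p : Option (Fin 3 × Fin 3)) : ℤ :=
  p.elim 1 fun c => sign (squareBit y t c.1 c.2)

theorem sum_character_mul_A (a b : MagicVA) :
    ∑ s, character s a.val * character s b.val = if a = b then 4 else 0 := by
  revert a b; decide +kernel

theorem sum_character_mul_B (a b : MagicVB) :
    ∑ s, character s a.val * character s b.val = if a = b then 4 else 0 := by
  revert a b; decide +kernel

theorem sum_A_character_mul (s t : Option (Fin 3)) :
    ∑ a : MagicVA, character s a.val * character t a.val = if s = t then 4 else 0 := by
  revert s t; decide +kernel

theorem sum_B_character_mul (s t : Option (Fin 3)) :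
    ∑ a : MagicVB, character s a.val * character t a.val = if s = t then 4 else 0 := by
  revert s t; decide +kernel

theorem squareBit_row (y : Fin 3) (t) (i : Fin 3) :
    squareBit y t i 0 + squareBit y t i 1 + squareBit y t i 2 = 0 := by
  revert y t i; decide +kernel

theorem squareBit_col (x y : Fin 3) (t) (j : Fin 3) :
    let b : Fin 3 → ZMod 2 := fun i => squareBit y t i j + if (i, j) = (x, y) then 1 else 0
    b 0 + b 1 + b 2 = 1 := by
  revert x y t j; decide +kernel

theorem sum_squareSign_mul (y : Fin 3) (p r : Option (Fin 3 × Fin 3)) :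
    ∑ t, squareSign y t p * squareSign y t r = if p = r then 16 else 0 := by
  revert y p r; decide +kernel

theorem squareSign_mul_self (y : Fin 3) (t) (p : Option (Fin 3 × Fin 3)) :
    squareSign y t p * squareSign y t p = 1 := by
  revert y t p; decide +kernel

theorem squareSign_mul_squareSign (y i i' i'' : Fin 3) (t) (h : i ≠ i') (h' : i' ≠ i'')
    (h'' : i ≠ i'') :
    squareSign y t (some (i, y)) * squareSign y t (some (i', y)) =
      squareSign y t (some (i'', y)) := by
  revert y i i' i'' t; decide +kernel

theorem sum_squareSign_mul_mul (y i i' l j : Fin 3) (r : Option (Fin 3 × Fin 3))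
    (hi : i ≠ i') (hl : l = i ∨ l = i') (hj : j ≠ y) :
    ∑ t, squareSign y t (some (l, j)) * squareSign y t (some (i, y)) *
      squareSign y t (some (i', y)) * squareSign y t r = 0 := by
  revert y i i' l j r; decide +kernel

/-- The scaled correlators of a deterministic strategy pair, including the marginal ones. -/
noncomputable def correlators (A : Fin 3 → MagicVA) (B : Fin 3 → MagicVB) :
    Option (Fin 3 × Fin 3) × Option (Fin 3 × Fin 3) → ℝ := fun p =>
  ((p.1.elim 1 fun c => sign ((A c.1).val c.2) : ℤ) : ℝ) *
    ((p.2.elim 1 fun c => sign ((B c.2).val c.1) : ℤ) : ℝ)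

/-- Fourier inversion: the probability vector with given correlators. -/
noncomputable def ofCorrelators :
    (Option (Fin 3 × Fin 3) × Option (Fin 3 × Fin 3) → ℝ) →ₗ[ℝ]
      (((Fin 3 × Fin 3) × MagicVA × MagicVB) → ℝ) where
  toFun M q := 16⁻¹ * ∑ s : Option (Fin 3), ∑ t : Option (Fin 3),
    (character s q.2.1.val : ℝ) * (character t q.2.2.val : ℝ) *
      M (s.map fun j => (q.1.1, j), t.map fun i => (i, q.1.2))
  map_add' M N := by
    ext q
    simp only [Pi.add_apply, mul_add, Finset.sum_add_distrib]
  map_smul' c M := by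
    ext q
    simp only [Pi.smul_apply, smul_eq_mul, RingHom.id_apply, Finset.mul_sum]
    exact Finset.sum_congr rfl fun s _ => Finset.sum_congr rfl fun t _ => by ring

theorem ofCorrelators_correlators (A : Fin 3 → MagicVA) (B : Fin 3 → MagicVB) :
    ofCorrelators (correlators A B) = detVector A B := by
  ext ⟨⟨x, y⟩, a, b⟩
  have hA := congrArg (Int.cast : ℤ → ℝ) (sum_character_mul_A a (A x))
  have hB := congrArg (Int.cast : ℤ → ℝ) (sum_character_mul_B b (B y))
  push_cast at hA hB
  have hfactor : ofCorrelators (correlators A B) ((x, y), a, b) =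
      16⁻¹ * ((∑ s, (character s a.val : ℝ) * (character s (A x).val : ℝ)) *
        ∑ t, (character t b.val : ℝ) * (character t (B y).val : ℝ)) := by
    simp only [ofCorrelators, LinearMap.coe_mk, AddHom.coe_mk, Finset.sum_mul_sum]
    congr 1
    refine Finset.sum_congr rfl fun s _ => Finset.sum_congr rfl fun t _ => ?_
    cases s <;> cases t <;> (simp [correlators, character]; try ring)
  rw [hfactor, hA, hB]
  simp only [detVector, eq_comm (a := A x), eq_comm (a := B y)]
  by_cases ha : a = A x <;> by_cases hb : b = B y <;> (simp [ha, hb]; try norm_num)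

theorem sum_ofCorrelators (M : Option (Fin 3 × Fin 3) × Option (Fin 3 × Fin 3) → ℝ)
    (x y : Fin 3) (s t : Option (Fin 3)) :
    ∑ a, ∑ b, (character s a.val : ℝ) * (character t b.val : ℝ) *
      ofCorrelators M ((x, y), a, b) =
      M (s.map fun j => (x, j), t.map fun i => (i, y)) := by
  have hA (s') := congrArg (Int.cast : ℤ → ℝ) (sum_A_character_mul s s')
  have hB (t') := congrArg (Int.cast : ℤ → ℝ) (sum_B_character_mul t t')
  push_cast at hA hB
  calc
    _ = ∑ s' : Option (Fin 3), ∑ t' : Option (Fin 3),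
        16⁻¹ * ((∑ a : MagicVA, (character s a.val : ℝ) * (character s' a.val : ℝ)) *
          ∑ b : MagicVB, (character t b.val : ℝ) * (character t' b.val : ℝ)) *
        M (s'.map fun j => (x, j), t'.map fun i => (i, y)) := by
      simp only [ofCorrelators, LinearMap.coe_mk, AddHom.coe_mk,
        Finset.mul_sum, Finset.sum_mul]
      conv_lhs =>
        enter [2, a]
        rw [Finset.sum_comm]
        enter [2, s']
        rw [Finset.sum_comm]
      rw [Finset.sum_comm]
      refine Finset.sum_congr rfl fun s' _ => ?_
      rw [Finset.sum_comm]
      refine Finset.sum_congr rfl fun t' _ => ?_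
      rw [Finset.sum_comm]
      refine Finset.sum_congr rfl fun b _ => Finset.sum_congr rfl fun a _ => ?_
      ring
    _ = _ := by
      simp only [hA, hB]
      rw [Finset.sum_eq_single s (fun s' _ h => by simp [h.symm]) (by simp),
        Finset.sum_eq_single t (fun t' _ h => by simp [h.symm]) (by simp)]
      norm_num

theorem ofCorrelators_injective : Function.Injective ofCorrelators := by
  intro M N h
  have key (x y : Fin 3) (s t : Option (Fin 3)) :
      M (s.map fun j => (x, j), t.map fun i => (i, y)) =
        N (s.map fun j => (x, j), t.map fun i => (i, y)) := by
    rw [← sum_ofCorrelators M, ← sum_ofCorrelators N, h]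
  ext ⟨_ | ⟨x, j⟩, _ | ⟨i, y⟩⟩
  · exact key 0 0 none none
  · exact key 0 y none (some i)
  · exact key x 0 (some j) none
  · exact key x y (some j) (some i)

/-- The normalization and the sum of the nine correlators occurring in the game. -/
noncomputable def gameValue :
    (Option (Fin 3 × Fin 3) × Option (Fin 3 × Fin 3) → ℝ) →ₗ[ℝ] ℝ × ℝ :=
  (LinearMap.proj (none, none)).prod (∑ c : Fin 3 × Fin 3, LinearMap.proj (some c, some c))

theorem gameValue_apply (M : Option (Fin 3 × Fin 3) × Option (Fin 3 × Fin 3) → ℝ) :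
    gameValue M = (M (none, none), ∑ c : Fin 3 × Fin 3, M (some c, some c)) := by
  simp [gameValue]

theorem finrank_ker_gameValue : Module.finrank ℝ (LinearMap.ker gameValue) = 98 := by
  have hsurj : LinearMap.range gameValue = ⊤ := by
    rw [LinearMap.range_eq_top]
    rintro ⟨u, w⟩
    refine ⟨fun p => if p.1 = none then u else w / 9, ?_⟩
    simp [gameValue_apply]
    ring
  have h := gameValue.finrank_range_add_finrank_ker
  rw [hsurj, finrank_top, Module.finrank_prod, Module.finrank_self,
    Module.finrank_fintype_fun_eq_card] at h
  simp at h
  omega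

theorem gameValue_correlators {A : Fin 3 → MagicVA} {B : Fin 3 → MagicVB}
    (h : (Finset.univ.filter
      (fun p : Fin 3 × Fin 3 => (A p.1).val p.2 = (B p.2).val p.1)).card = 8) :
    gameValue (correlators A B) = (1, 7) := by
  have hsign (a b : ZMod 2) : sign a * sign b = 2 * (if a = b then 1 else 0) - 1 := by
    revert a b; decide
  have hsum : ∑ c : Fin 3 × Fin 3, sign ((A c.1).val c.2) * sign ((B c.2).val c.1) = 7 := by
    simp only [hsign, Finset.sum_sub_distrib, ← Finset.mul_sum, Finset.sum_boole, h]
    simp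
  have hcast := congrArg (Int.cast : ℤ → ℝ) hsum
  push_cast at hcast
  simp [gameValue_apply, correlators, hcast]

/-- Alice's strategy given by the rows of a square of `squareBit`. -/
def squareA (y : Fin 3) (t : ZMod 2 × ZMod 2 × ZMod 2 × ZMod 2) : Fin 3 → MagicVA :=
  fun i => ⟨squareBit y t i, squareBit_row y t i⟩

/-- Bob's strategy given by the columns of a square of `squareBit`, with one bit flipped. -/
def squareB (x y : Fin 3) (t : ZMod 2 × ZMod 2 × ZMod 2 × ZMod 2) : Fin 3 → MagicVB :=
  fun j => ⟨fun i => squareBit y t i j + if (i, j) = (x, y) then 1 else 0, squareBit_col x y t j⟩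

theorem card_filter_eq_eight (a : Fin 3 × Fin 3 → ZMod 2) (b : Fin 3 × Fin 3 → ZMod 2)
    (k : Fin 3 × Fin 3) (h : ∀ p, b p = a p + if p = k then 1 else 0) :
    (Finset.univ.filter fun p => a p = b p).card = 8 := by
  have hset : (Finset.univ.filter fun p => a p = b p) = Finset.univ.erase k := by
    ext p
    by_cases hp : p = k <;> simp [h, hp]
  rw [hset, Finset.card_erase_of_mem (Finset.mem_univ k)]
  simp

theorem sign_add_one (z : ZMod 2) : sign (z + 1) = -sign z := by
  revert z; decide

section Column

variable {C : Option (Fin 3 × Fin 3) × Option (Fin 3 × Fin 3) → ℝ} {y : Fin 3} {c : ℝ}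

/-- The functional with coefficients `C` takes the value `c` on the correlators of all strategy
pairs losing only in column `y`. -/
def IsConstOnColumn (C : Option (Fin 3 × Fin 3) × Option (Fin 3 × Fin 3) → ℝ) (y : Fin 3)
    (c : ℝ) : Prop :=
  ∀ x t, ∑ p, ∑ q, (squareSign y t p : ℝ) *
    ((if q = some (x, y) then -squareSign y t q else squareSign y t q : ℤ) : ℝ) * C (p, q) = c

theorem IsConstOnColumn.sum_mul_eq (h : IsConstOnColumn C y c) (x t) :
    ∑ p, ∑ q, (squareSign y t p : ℝ) * (squareSign y t q : ℝ) * C (p, q) -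
      2 * ∑ p, (squareSign y t (some (x, y)) : ℝ) * (squareSign y t p : ℝ) * C (p, some (x, y)) =
      c := by
  rw [← h x t, Finset.mul_sum, ← Finset.sum_sub_distrib]
  refine Finset.sum_congr rfl fun p _ => ?_
  rw [sub_eq_iff_eq_add, ← sub_eq_iff_eq_add', ← Finset.sum_sub_distrib,
    Finset.sum_eq_single (some (x, y)) (fun q _ hq => by simp [hq]) (by simp)]
  simp
  ring

theorem IsConstOnColumn.sum_sum_mul_eq (h : IsConstOnColumn C y c) (i i' : Fin 3)
    (w : ZMod 2 × ZMod 2 × ZMod 2 × ZMod 2 → ℤ) :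
    ∑ p, ((∑ t, w t * squareSign y t (some (i, y)) * squareSign y t p : ℤ) : ℝ) *
        C (p, some (i, y)) =
      ∑ p, ((∑ t, w t * squareSign y t (some (i', y)) * squareSign y t p : ℤ) : ℝ) *
        C (p, some (i', y)) := by
  have hswap (l : Fin 3) :
      ∑ p, ((∑ t, w t * squareSign y t (some (l, y)) * squareSign y t p : ℤ) : ℝ) *
          C (p, some (l, y)) =
        ∑ t, (w t : ℝ) * ∑ p, (squareSign y t (some (l, y)) : ℝ) * (squareSign y t p : ℝ) *
          C (p, some (l, y)) := by
    simp only [Int.cast_sum, Int.cast_mul, Finset.sum_mul, Finset.mul_sum]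
    rw [Finset.sum_comm]
    exact Finset.sum_congr rfl fun t _ => Finset.sum_congr rfl fun p _ => by ring
  rw [hswap, hswap]
  refine Finset.sum_congr rfl fun t _ => ?_
  have h₁ := h.sum_mul_eq i t
  have h₂ := h.sum_mul_eq i' t
  congr 1
  linarith

theorem IsConstOnColumn.off_column (h : IsConstOnColumn C y c) {i l j : Fin 3} (hj : j ≠ y) :
    C (some (l, j), some (i, y)) = 0 := by
  obtain ⟨i', hi, hl⟩ : ∃ i', i ≠ i' ∧ (l = i ∨ l = i') := by
    revert i l; decide
  have key := h.sum_sum_mul_eq i i'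
    fun t => squareSign y t (some (l, j)) * squareSign y t (some (i, y))
  simp only [sum_squareSign_mul_mul y i i' l j _ hi hl hj] at key
  simpa [mul_assoc _ (squareSign y _ (some (i, y))), squareSign_mul_self,
    sum_squareSign_mul] using key

theorem IsConstOnColumn.diagonal (h : IsConstOnColumn C y c) (i i' : Fin 3) :
    C (some (i, y), some (i, y)) = C (some (i', y), some (i', y)) := by
  have key := h.sum_sum_mul_eq i i' fun _ => 1
  simpa [sum_squareSign_mul] using key

theorem IsConstOnColumn.marginal (h : IsConstOnColumn C y c) {i i' i'' : Fin 3} (h₁ : i ≠ i')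
    (h₂ : i' ≠ i'') (h₃ : i ≠ i'') :
    C (none, some (i, y)) = C (some (i'', y), some (i', y)) := by
  have key := h.sum_sum_mul_eq i i' fun t => squareSign y t (some (i, y))
  have hone (t) : (1 : ℤ) = squareSign y t none := rfl
  simp only [squareSign_mul_self, squareSign_mul_squareSign y i i' i'' _ h₁ h₂ h₃,
    sum_squareSign_mul] at key
  simp only [fun t p => congrArg (· * squareSign y t p) (hone t), sum_squareSign_mul] at key
  simpa using key

end Column

/-- A functional constant on all pairs winning exactly 8 inputs is constant on those losing in
column `y`. -/
theorem isConstOnColumn_of_forall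
    {C : Option (Fin 3 × Fin 3) × Option (Fin 3 × Fin 3) → ℝ} {c : ℝ}
    (h : ∀ (A : Fin 3 → MagicVA) (B : Fin 3 → MagicVB),
      (Finset.univ.filter
        (fun p : Fin 3 × Fin 3 => (A p.1).val p.2 = (B p.2).val p.1)).card = 8 →
      ∑ p, ∑ q, correlators A B (p, q) * C (p, q) = c) (y : Fin 3) :
    IsConstOnColumn C y c := by
  intro x t
  rw [← h (squareA y t) (squareB x y t)
    (card_filter_eq_eight _ _ (x, y) fun p => by
      simp [squareA, squareB, Prod.ext_iff])]
  refine Finset.sum_congr rfl fun p _ => Finset.sum_congr rfl fun q _ => ?_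
  congr 1
  simp only [correlators, squareA, squareB]
  congr 2
  rcases q with _ | q
  · rfl
  · by_cases hq : q = (x, y) <;> simp [hq, squareSign, sign_add_one]

/-- Exchanging the players, with a global change of sign of the square, preserves the game. -/
theorem isConstOnColumn_swap_of_forall
    {C : Option (Fin 3 × Fin 3) × Option (Fin 3 × Fin 3) → ℝ} {c : ℝ}
    (h : ∀ (A : Fin 3 → MagicVA) (B : Fin 3 → MagicVB),
      (Finset.univ.filter
        (fun p : Fin 3 × Fin 3 => (A p.1).val p.2 = (B p.2).val p.1)).card = 8 →
      ∑ p, ∑ q, correlators A B (p, q) * C (p, q) = c) (y : Fin 3) :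
    IsConstOnColumn (fun p => p.1.elim 1 (fun _ => -1) * p.2.elim 1 (fun _ => -1) *
      C (p.2.map Prod.swap, p.1.map Prod.swap)) y c := by
  intro x t
  have hone : (1 : ZMod 2) + 1 = 0 := by decide
  let A : Fin 3 → MagicVA := fun j => ⟨fun i => (squareB x y t j).val i + 1, by
    linear_combination (squareB x y t j).property + 2 * hone⟩
  let B : Fin 3 → MagicVB := fun i => ⟨fun j => (squareA y t i).val j + 1, by
    linear_combination (squareA y t i).property + hone⟩
  let e : Option (Fin 3 × Fin 3) ≃ Option (Fin 3 × Fin 3) :=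
    Equiv.optionCongr (Equiv.prodComm (Fin 3) (Fin 3))
  have hcard : (Finset.univ.filter
      (fun p : Fin 3 × Fin 3 => (A p.1).val p.2 = (B p.2).val p.1)).card = 8 := by
    refine card_filter_eq_eight _ _ (y, x) fun p => ?_
    by_cases hp : p = (y, x)
    · simp [A, B, squareA, squareB, hp, add_assoc, hone]
    · have hp' : ¬(p.2 = x ∧ p.1 = y) := fun h' => hp (Prod.ext h'.2 h'.1)
      simp [A, B, squareA, squareB, hp, hp']
  rw [← h A B hcard]
  symm
  rw [Finset.sum_comm, ← e.sum_comp]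
  refine Finset.sum_congr rfl fun p _ => ?_
  rw [← e.sum_comp]
  refine Finset.sum_congr rfl fun q _ => ?_
  have hA : ((e q).elim 1 fun c => sign ((A c.1).val c.2) : ℤ) =
      (q.elim 1 fun _ => -1) *
        if q = some (x, y) then -squareSign y t q else squareSign y t q := by
    rcases q with _ | q
    · rfl
    · by_cases hq : q = (x, y)
      · simp [e, A, squareB, hq, squareSign, sign_add_one]
      · have hq' : ¬(q.1 = x ∧ q.2 = y) := fun h' => hq (Prod.ext h'.1 h'.2)
        simp [e, A, squareB, hq, hq', squareSign, sign_add_one]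
  have hB : ((e p).elim 1 fun c => sign ((B c.2).val c.1) : ℤ) =
      (p.elim 1 fun _ => -1) * squareSign y t p := by
    rcases p with _ | p
    · rfl
    · simp [e, B, squareA, squareSign, sign_add_one]
  simp only [correlators, hA, hB]
  have he (p) : e p = p.map Prod.swap := rfl
  simp only [he, Int.cast_mul]
  rcases p with _ | p <;> rcases q with _ | q <;> simp only [Option.elim] <;> push_cast <;> ring

/-- The game value and the normalization are, up to combinations, the only functionals constant on
the correlators of the strategy pairs winning exactly 8 inputs. -/
theorem coefficients_of_forall
    {C : Option (Fin 3 × Fin 3) × Option (Fin 3 × Fin 3) → ℝ} {c : ℝ}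
    (h : ∀ (A : Fin 3 → MagicVA) (B : Fin 3 → MagicVB),
      (Finset.univ.filter
        (fun p : Fin 3 × Fin 3 => (A p.1).val p.2 = (B p.2).val p.1)).card = 8 →
      ∑ p, ∑ q, correlators A B (p, q) * C (p, q) = c) :
    (∀ p q, p ≠ q → C (p, q) = 0) ∧
      ∀ k : Fin 3 × Fin 3, C (some k, some k) = C (some (0, 0), some (0, 0)) := by
  have hcol := isConstOnColumn_of_forall h
  have hrow := isConstOnColumn_swap_of_forall h
  have hcell (p q : Fin 3 × Fin 3) (hpq : p ≠ q) : C (some p, some q) = 0 := by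
    by_cases hy : p.2 = q.2
    · have hx : q.1 ≠ p.1 := fun hx => hpq (Prod.ext hx.symm hy)
      simpa using (hrow p.1).off_column (i := p.2) (l := q.2) hx
    · exact (hcol q.2).off_column hy
  have hthird (i : Fin 3) : ∃ i' i'', i ≠ i' ∧ i' ≠ i'' ∧ i ≠ i'' := by
    revert i; decide
  refine ⟨?_, fun k => ?_⟩
  · rintro (_ | ⟨x, y⟩) (_ | ⟨x', y'⟩) hpq
    · exact absurd rfl hpq
    · obtain ⟨i', i'', h₁, h₂, h₃⟩ := hthird x'
      rw [(hcol y').marginal h₁ h₂ h₃]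
      exact hcell _ _ (by simp [h₂.symm])
    · obtain ⟨i', i'', h₁, h₂, h₃⟩ := hthird y
      have key := (hrow x).marginal h₁ h₂ h₃
      simp only [Option.map_some, Option.map_none, Prod.swap_prod_mk,
        hcell (x, i') (x, i'') (by simp [h₂])] at key
      simpa using key
    · exact hcell _ _ (by simpa using hpq)
  · have key := (hrow k.1).diagonal k.2 0
    simp only [Option.map_some, Prod.swap_prod_mk] at key
    rw [← (hcol 0).diagonal k.1 0]
    simpa using key

theorem vectorSpan_correlators :
    vectorSpan ℝ {M | ∃ (A : Fin 3 → MagicVA) (B : Fin 3 → MagicVB),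
      (Finset.univ.filter
        (fun p : Fin 3 × Fin 3 => (A p.1).val p.2 = (B p.2).val p.1)).card = 8 ∧
      M = correlators A B} = LinearMap.ker gameValue := by
  apply le_antisymm
  · rw [vectorSpan_def, Submodule.span_le]
    rintro _ ⟨_, ⟨A, B, h, rfl⟩, _, ⟨A', B', h', rfl⟩, rfl⟩
    simp [gameValue_correlators h, gameValue_correlators h']
  · intro M hM
    by_contra hMs
    obtain ⟨f, hf, hle⟩ := Submodule.exists_le_ker_of_notMem hMs
    have hexpand (N) : f N = ∑ p, ∑ q, N (p, q) * f (Pi.single (p, q) 1) := by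
      rw [← Fintype.sum_prod_type' fun p q => N (p, q) * f (Pi.single (p, q) 1),
        f.pi_apply_eq_sum_univ]
      refine Finset.sum_congr rfl fun p _ => congrArg (N p * f ·) ?_
      ext q
      simp [Pi.single_apply, eq_comm]
    let A₀ := squareA 0 0
    let B₀ := squareB 0 0 0
    have h₀ : (Finset.univ.filter
        (fun p : Fin 3 × Fin 3 => (A₀ p.1).val p.2 = (B₀ p.2).val p.1)).card = 8 := by
      decide +kernel
    obtain ⟨hoff, hdiag⟩ := coefficients_of_forall (C := fun p => f (Pi.single p 1))
      (c := f (correlators A₀ B₀)) fun A B h => by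
        rw [← hexpand, ← sub_eq_zero, ← map_sub]
        exact hle (vsub_mem_vectorSpan ℝ ⟨A, B, h, rfl⟩ ⟨A₀, B₀, h₀, rfl⟩)
    apply hf
    simp only [LinearMap.mem_ker, gameValue_apply, Prod.mk_eq_zero] at hM
    have hsum (p) : ∑ q, M (p, q) * f (Pi.single (p, q) 1) =
        M (p, p) * f (Pi.single (p, p) 1) :=
      Finset.sum_eq_single p (fun q _ hq => by simp [hoff p q hq.symm]) (by simp)
    simp only [hexpand M, hsum, Fintype.sum_option, hM.1, hdiag, ← Finset.sum_mul, hM.2]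
    simp

end MagicSquare

/-- **The Magic Square inequality is a tight Bell-type inequality (a facet of
`Ω₃₄`).**  The affine span of the 144 deterministic probability vectors coming
from strategy pairs that win on exactly 8 of the 9 inputs has dimension 98,
i.e. one less than the dimension 99 of the no-signalling space in which the
local polytope `Ω₃₄` is full-dimensional. -/
theorem magic_square_inequality_is_facet :
    Module.finrank ℝ
      (affineSpan ℝ
        {v : ((Fin 3 × Fin 3) × MagicVA × MagicVB) → ℝ |
          ∃ (A : Fin 3 → MagicVA) (B : Fin 3 → MagicVB),
            (Finset.univ.filter
              (fun p : Fin 3 × Fin 3 => (A p.1).val p.2 = (B p.2).val p.1)).card = 8 ∧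
            v = detVector A B}).direction = 98 := by
  have himage : {v : ((Fin 3 × Fin 3) × MagicVA × MagicVB) → ℝ |
      ∃ (A : Fin 3 → MagicVA) (B : Fin 3 → MagicVB),
        (Finset.univ.filter
          (fun p : Fin 3 × Fin 3 => (A p.1).val p.2 = (B p.2).val p.1)).card = 8 ∧
        v = detVector A B} =
      MagicSquare.ofCorrelators.toAffineMap '' {M | ∃ (A : Fin 3 → MagicVA) (B : Fin 3 → MagicVB),
        (Finset.univ.filter
          (fun p : Fin 3 × Fin 3 => (A p.1).val p.2 = (B p.2).val p.1)).card = 8 ∧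
        M = MagicSquare.correlators A B} := by
    ext v
    constructor
    · rintro ⟨A, B, h, rfl⟩
      exact ⟨_, ⟨A, B, h, rfl⟩, MagicSquare.ofCorrelators_correlators A B⟩
    · rintro ⟨_, ⟨A, B, h, rfl⟩, rfl⟩
      exact ⟨A, B, h, MagicSquare.ofCorrelators_correlators A B⟩
  rw [direction_affineSpan, himage, ← AffineMap.map_vectorSpan, MagicSquare.vectorSpan_correlators,
    LinearMap.toAffineMap_linear, ← MagicSquare.finrank_ker_gameValue]
  exact (Submodule.equivMapOfInjective _ MagicSquare.ofCorrelators_injective _).finrank_eq.symm
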